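/- For q ∈ [0,1] let ρ_G(q) = q·|Ψ₋⟩⟨Ψ₋| + (1−q)·|0⟩⟨0| ⊗ (I₂/2) be a density matrix on ℂ² ⊗ ℂ². Then tr(V·ρ_G(q)) = (1 − 3q)/2, where V is the flip operator; consequently, for every q > 1/3 the state ρ_G(q) is not separable. -/

import Mathlib

open Matrix Kronecker
open scoped ComplexOrder

noncomputable section

/-- The flip operator on `ℂ² ⊗ ℂ²`, identified with `ℂ⁴` via the Kronecker
product: `V[(i,j),(k,l)] = 1` if `i = l` and `j = k`, and `0` otherwise. -/
def flipOp : Matrix (Fin 2 × Fin 2) (Fin 2 × Fin 2) ℂ :=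
  Matrix.of fun p q => if p.1 = q.2 ∧ p.2 = q.1 then 1 else 0

/-- The singlet state vector `|Ψ₋⟩ = (|01⟩ − |10⟩)/√2` of `ℂ² ⊗ ℂ²`. -/
def singletVec : Fin 2 × Fin 2 → ℂ := fun p =>
  if p = (0, 1) then ((Real.sqrt 2 : ℝ) : ℂ)⁻¹
  else if p = (1, 0) then -((Real.sqrt 2 : ℝ) : ℂ)⁻¹
  else 0

/-- The singlet density matrix `|Ψ₋⟩⟨Ψ₋|`. -/
def singletState : Matrix (Fin 2 × Fin 2) (Fin 2 × Fin 2) ℂ :=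
  Matrix.of fun p q => singletVec p * (starRingEnd ℂ) (singletVec q)

/-- The rank-one projector `|0⟩⟨0|` on `ℂ²`. -/
def ket0bra0 : Matrix (Fin 2) (Fin 2) ℂ :=
  Matrix.of fun i j => if i = 0 ∧ j = 0 then 1 else 0

/-- The state `ρ_G(q) = q·|Ψ₋⟩⟨Ψ₋| + (1−q)·|0⟩⟨0| ⊗ (I₂/2)`. -/
def rhoG (q : ℝ) : Matrix (Fin 2 × Fin 2) (Fin 2 × Fin 2) ℂ :=
  (q : ℂ) • singletState +
    ((1 - q : ℝ) : ℂ) • (ket0bra0 ⊗ₖ ((2 : ℂ)⁻¹ • (1 : Matrix (Fin 2) (Fin 2) ℂ)))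

/-- A density matrix `ρ` on `ℂ² ⊗ ℂ²` is separable if it is a finite convex
combination `Σᵢ pᵢ Aᵢ ⊗ Bᵢ` of Kronecker products of density matrices on `ℂ²`. -/
def SeparableState (ρ : Matrix (Fin 2 × Fin 2) (Fin 2 × Fin 2) ℂ) : Prop :=
  ∃ (n : ℕ) (p : Fin n → ℝ) (A B : Fin n → Matrix (Fin 2) (Fin 2) ℂ),
    (∀ i, 0 ≤ p i) ∧ (∑ i, p i = 1) ∧
    (∀ i, (A i).PosSemidef ∧ (A i).trace = 1) ∧
    (∀ i, (B i).PosSemidef ∧ (B i).trace = 1) ∧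
    ρ = ∑ i, (p i : ℂ) • (A i ⊗ₖ B i)

/-- The trace of a product of two positive semidefinite matrices is nonnegative. -/
theorem Matrix.PosSemidef.zero_le_trace_mul {n : Type*} [Fintype n]
    {A B : Matrix n n ℂ} (hA : A.PosSemidef) (hB : B.PosSemidef) :
    0 ≤ (A * B).trace := by
  obtain ⟨m, v, rfl⟩ := Matrix.posSemidef_iff_eq_sum_vecMulVec.mp hB
  simp only [Matrix.mul_sum, Matrix.trace_sum, Matrix.mul_vecMulVec, Matrix.trace_vecMulVec]
  exact Finset.sum_nonneg fun i _ => dotProduct_comm _ (star (v i)) ▸ hA.dotProduct_mulVec_nonneg _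

/-- The swap trick: `tr(V (A ⊗ B)) = tr(A B)`. -/
theorem trace_flipOp_mul_kronecker (A B : Matrix (Fin 2) (Fin 2) ℂ) :
    (flipOp * (A ⊗ₖ B)).trace = (A * B).trace := by
  simp [flipOp, Matrix.trace, Matrix.mul_apply, Fintype.sum_prod_type, Fin.sum_univ_two]
  ring

theorem trace_flipOp_mul_singletState : (flipOp * singletState).trace = -1 := by
  have h : ((Real.sqrt 2 : ℝ) : ℂ)⁻¹ * ((Real.sqrt 2 : ℝ) : ℂ)⁻¹ = 2⁻¹ := by
    rw [← mul_inv, ← Complex.ofReal_mul, Real.mul_self_sqrt (by norm_num), Complex.ofReal_ofNat]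
  simp [flipOp, singletState, singletVec, Matrix.trace, Matrix.mul_apply,
    Fintype.sum_prod_type, Fin.sum_univ_two, h]
  norm_num

theorem trace_flipOp_mul_rhoG (q : ℝ) :
    (flipOp * rhoG q).trace = (((1 - 3 * q) / 2 : ℝ) : ℂ) := by
  have h : ket0bra0.trace = 1 := by simp [ket0bra0, Matrix.trace]
  simp only [rhoG, Matrix.mul_add, Matrix.mul_smul, Matrix.trace_add, Matrix.trace_smul,
    trace_flipOp_mul_singletState, trace_flipOp_mul_kronecker, Matrix.mul_one, h, smul_eq_mul]
  push_cast
  ring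

/-- The flip operator is an entanglement witness. -/
theorem SeparableState.zero_le_trace_flipOp_mul
    {ρ : Matrix (Fin 2 × Fin 2) (Fin 2 × Fin 2) ℂ} (h : SeparableState ρ) :
    0 ≤ (flipOp * ρ).trace := by
  obtain ⟨n, p, A, B, hp, -, hA, hB, rfl⟩ := h
  simp only [Matrix.mul_sum, Matrix.trace_sum, Matrix.mul_smul, Matrix.trace_smul,
    trace_flipOp_mul_kronecker, smul_eq_mul]
  exact Finset.sum_nonneg fun i _ =>
    mul_nonneg (Complex.zero_le_real.mpr (hp i)) ((hA i).1.zero_le_trace_mul (hB i).1)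

/-- For `q ∈ [0,1]`, `tr(V·ρ_G(q)) = (1 − 3q)/2`; consequently `ρ_G(q)` is not
separable for `q > 1/3`. -/
theorem trace_flip_rhoG (q : ℝ) (hq0 : 0 ≤ q) (hq1 : q ≤ 1) :
    Matrix.trace (flipOp * rhoG q) = (((1 - 3 * q) / 2 : ℝ) : ℂ) ∧
      (1 / 3 < q → ¬ SeparableState (rhoG q)) := by
  refine ⟨trace_flipOp_mul_rhoG q, fun hq hsep => ?_⟩
  have h := hsep.zero_le_trace_flipOp_mul
  rw [trace_flipOp_mul_rhoG, Complex.zero_le_real] at h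
  linarith

end
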